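/- Let t be a binary tree, let b ≥ 1 be a natural number, and suppose there is a real constant c > 1 such that h(t[v]) ≤ log_c(|t[v]| + 1) for every node v of t. Then the number of heavy nodes satisfies n_{≥b}(t) ≤ 4·|t|·(log₂ b + 2)/(b·log₂ c) + 2·|t|/b. -/

import Mathlib

inductive BinTree : Type where
  | leaf : BinTree
  | node : BinTree → BinTree → BinTree
deriving DecidableEq

namespace BinTree

def size : BinTree → ℕ
  | leaf => 0
  | node l r => 1 + size l + size r

def height : BinTree → ℕ
  | leaf => 0
  | node l r => 1 + max (height l) (height r)

def subtreeAt : BinTree → List Bool → BinTree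
  | t, [] => t
  | leaf, _ :: _ => leaf
  | node l r, b :: v => subtreeAt (if b then r else l) v

def countGE (b : ℕ) : BinTree → ℕ
  | leaf => 0
  | node l r => (if b ≤ size (node l r) then 1 else 0) + countGE b l + countGE b r

end BinTree

noncomputable def fsProb (p : ℕ → ℕ → ℝ) : BinTree → ℝ
  | .leaf => 1
  | .node l r => p l.size r.size * fsProb p l * fsProb p r

noncomputable def fhProb (p : ℕ → ℕ → ℝ) : BinTree → ℝ
  | .leaf => 1
  | .node l r => p l.height r.height * fhProb p l * fhProb p r

def IsFixedSizeSource (p : ℕ → ℕ → ℝ) : Prop :=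
  (∀ ℓ r, 0 ≤ p ℓ r ∧ p ℓ r ≤ 1) ∧
  ∀ n : ℕ, ∑ ℓ ∈ Finset.range (n + 1), p ℓ (n - ℓ) = 1

def IsFixedHeightSource (p : ℕ → ℕ → ℝ) : Prop :=
  (∀ i j, 0 ≤ p i j ∧ p i j ≤ 1) ∧
  ∀ h : ℕ,
    ∑ ij ∈ (Finset.range (h + 1) ×ˢ Finset.range (h + 1)).filter
        (fun ij => max ij.1 ij.2 = h), p ij.1 ij.2 = 1

theorem BinTree.countGE_zero (s : ℕ) (t : BinTree) (h : t.size < s) : t.countGE s = 0 := by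
  induction t with
  | leaf => rfl
  | node l r ihl ihr =>
    simp only [BinTree.size] at h
    simp only [BinTree.countGE]
    rw [ihl (by omega), ihr (by omega), if_neg (by simp only [BinTree.size]; omega)]

theorem BinTree.countGE_height (s : ℕ) (t : BinTree) (h : t.size < 2 * s) :
    t.countGE s ≤ t.height := by
  induction t with
  | leaf => simp [BinTree.countGE]
  | node l r ihl ihr =>
    simp only [BinTree.size] at h
    have h1 := ihl (by omega)
    have h2 := ihr (by omega)
    have h3 : l.countGE s = 0 ∨ r.countGE s = 0 := by
      by_cases hl : l.size < s
      · exact Or.inl (BinTree.countGE_zero s l hl)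
      · exact Or.inr (BinTree.countGE_zero s r (by omega))
    simp only [BinTree.countGE, BinTree.height]
    split_ifs <;> omega

theorem BinTree.countGE_double (s : ℕ) (hs : 1 ≤ s) (c : ℝ) (hc : 1 < c) (t : BinTree)
    (hheight : ∀ v : List Bool, t.subtreeAt v ≠ BinTree.leaf →
      ((t.subtreeAt v).height : ℝ) ≤ Real.logb c (((t.subtreeAt v).size : ℝ) + 1)) :
    (s : ℝ) * t.countGE s ≤ s * t.countGE (2 * s) + t.size * Real.logb c (2 * s) := by
  have hs' : (1 : ℝ) ≤ s := by exact_mod_cast hs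
  have hL : 0 ≤ Real.logb c (2 * s) := Real.logb_nonneg hc (by linarith)
  induction t with
  | leaf => simp [BinTree.countGE, BinTree.size]
  | node l r ihl ihr =>
    have h1 := ihl (fun v => by simpa [BinTree.subtreeAt] using hheight (false :: v))
    have h2 := ihr (fun v => by simpa [BinTree.subtreeAt] using hheight (true :: v))
    by_cases hbig : 2 * s ≤ (BinTree.node l r).size
    · simp only [BinTree.countGE]
      rw [if_pos hbig, if_pos (by omega)]
      simp only [BinTree.size]
      push_cast
      nlinarith
    · push Not at hbig
      by_cases hsm : (BinTree.node l r).size < s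
      · rw [BinTree.countGE_zero s _ hsm]
        push_cast
        rw [mul_zero]
        positivity
      · have h3 := BinTree.countGE_height s _ hbig
        have h4 := hheight [] (by simp [BinTree.subtreeAt])
        simp only [BinTree.subtreeAt] at h4
        generalize BinTree.node l r = t at *
        have h5 : Real.logb c ((t.size : ℝ) + 1) ≤ Real.logb c (2 * s) := by
          apply Real.logb_le_logb_of_le hc (by positivity)
          exact_mod_cast hbig
        have h6 : (s : ℝ) ≤ t.size := by exact_mod_cast not_lt.mp hsm
        have h7 : (t.countGE s : ℝ) ≤ t.height := by exact_mod_cast h3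
        have h8 : (s : ℝ) * t.countGE s ≤ t.size * Real.logb c (2 * s) := by
          apply mul_le_mul h6 (by linarith) (by positivity) (by positivity)
        have : (0 : ℝ) ≤ s * t.countGE (2 * s) := by positivity
        linarith

theorem BinTree.countGE_iter (b : ℕ) (hb : 1 ≤ b) (c : ℝ) (hc : 1 < c) (t : BinTree)
    (hheight : ∀ v : List Bool, t.subtreeAt v ≠ BinTree.leaf →
      ((t.subtreeAt v).height : ℝ) ≤ Real.logb c (((t.subtreeAt v).size : ℝ) + 1)) (K : ℕ) :
    (t.countGE b : ℝ) ≤ t.countGE (2 ^ K * b) + t.size / b *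
      (2 * Real.logb c b + 4 * Real.logb c 2
        - (2 * Real.logb c b + (2 * K + 4) * Real.logb c 2) / 2 ^ K) := by
  have hb' : (0 : ℝ) < b := by exact_mod_cast hb
  induction K with
  | zero => simp
  | succ K ih =>
    have hp : 0 < 2 ^ K * b := by positivity
    have h := BinTree.countGE_double (2 ^ K * b) hp c hc t hheight
    have e : 2 * (2 ^ K * b) = 2 ^ (K + 1) * b := by ring
    have e2 : Real.logb c (2 * ((2 ^ K * b : ℕ) : ℝ))
        = Real.logb c b + (K + 1) * Real.logb c 2 := by
      have : (2 * ((2 ^ K * b : ℕ) : ℝ)) = 2 ^ (K + 1) * b := by push_cast; ring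
      rw [this, Real.logb_mul (by positivity) (by positivity), Real.logb_pow]
      push_cast; ring
    rw [e, e2] at h
    have hp' : (0 : ℝ) < 2 ^ K * b := by exact_mod_cast hp
    have h' : (t.countGE (2 ^ K * b) : ℝ) ≤ t.countGE (2 ^ (K + 1) * b)
        + t.size * (Real.logb c b + (K + 1) * Real.logb c 2) / (2 ^ K * b) := by
      rw [← sub_le_iff_le_add', le_div_iff₀ hp']
      push_cast at h
      linarith
    refine (ih.trans (add_le_add_left h' _)).trans (le_of_eq ?_)
    push_cast
    field_simp
    ring

/-- If every fringe subtree of `t` has height at most `log_c` of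
(its size + 1), then the number of nodes with subtree size ≥ b is at most
`4|t|(lg b + 2)/(b lg c) + 2|t|/b`. -/
theorem statement0 (t : BinTree) (b : ℕ) (hb : 1 ≤ b) (c : ℝ) (hc : 1 < c)
    (hheight : ∀ v : List Bool, t.subtreeAt v ≠ BinTree.leaf →
      ((t.subtreeAt v).height : ℝ) ≤ Real.logb c (((t.subtreeAt v).size : ℝ) + 1)) :
    (t.countGE b : ℝ) ≤
      4 * (t.size : ℝ) * (Real.logb 2 (b : ℝ) + 2) / ((b : ℝ) * Real.logb 2 c)
        + 2 * (t.size : ℝ) / (b : ℝ) := by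
  have hb' : (1 : ℝ) ≤ b := by exact_mod_cast hb
  have h := BinTree.countGE_iter b hb c hc t hheight t.size
  have hz : t.countGE (2 ^ t.size * b) = 0 :=
    BinTree.countGE_zero _ _ (lt_of_lt_of_le Nat.lt_two_pow_self (Nat.le_mul_of_pos_right _ hb))
  rw [hz] at h
  have hA : 0 ≤ Real.logb c b := Real.logb_nonneg hc hb'
  have hB : 0 ≤ Real.logb c 2 := Real.logb_nonneg hc (by norm_num)
  have hpos : 0 ≤ (2 * Real.logb c b + (2 * (t.size : ℝ) + 4) * Real.logb c 2)
      / 2 ^ t.size := by positivity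
  have hq : (0 : ℝ) ≤ t.size / b := by positivity
  have h1 : (t.countGE b : ℝ) ≤ t.size / b * (2 * Real.logb c b + 4 * Real.logb c 2) := by
    push_cast at h
    nlinarith [mul_nonneg hq hpos]
  have hlc : 0 < Real.log c := Real.log_pos hc
  have hl2 : 0 < Real.log 2 := Real.log_pos (by norm_num)
  have e : 4 * (t.size : ℝ) * (Real.logb 2 (b : ℝ) + 2) / ((b : ℝ) * Real.logb 2 c)
      = 2 * (t.size / b * (2 * Real.logb c b + 4 * Real.logb c 2)) := by
    simp only [Real.logb]
    field_simp
    ring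
  rw [e]
  have h2 : 0 ≤ t.size / b * (2 * Real.logb c b + 4 * Real.logb c 2) := by positivity
  have h3 : 0 ≤ 2 * (t.size : ℝ) / b := by positivity
  linarith
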